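/- For every ρ₁ ∈ (0,1) there exist ρ₂ ∈ (ρ₁,1) and a smooth function H₂ : W → ℝ such that: (i) H₂(w) ≥ −H^rot(w) for all w ∈ W, with equality for all w with |w| ≤ ρ₁; (ii) H₂(w) = H^hyp(w) for all w with ρ₂ ≤ |w| < 1; (iii) H₂ has exactly two critical points, namely the origin 0, which is a nondegenerate local maximum, and one further point w₂ with ρ₁ < |w₂| < ρ₂, which is a nondegenerate saddle point. -/

import Mathlib

/-- The open unit disc `W ⊆ ℂ`. -/
def Wdisc : Set ℂ := Metric.ball 0 1

/-- `H^rot(w) = (π/2)·(1+|w|²)/(1−|w|²)`. -/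
noncomputable def Hrot (w : ℂ) : ℝ := (Real.pi / 2) * (1 + ‖w‖ ^ 2) / (1 - ‖w‖ ^ 2)

/-- `H^hyp(w) = π·Re(w)/(1−|w|²)`. -/
noncomputable def Hhyp (w : ℂ) : ℝ := Real.pi * w.re / (1 - ‖w‖ ^ 2)

/-- The Hessian quadratic form of `H : ℂ → ℝ` at `w`, evaluated on `v`. -/
noncomputable def hessQ (H : ℂ → ℝ) (w v : ℂ) : ℝ := fderiv ℝ (fderiv ℝ H) w v v

/-- `w` is a nondegenerate local maximum of `H` (critical with negative
definite Hessian). -/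
def IsNondegMax (H : ℂ → ℝ) (w : ℂ) : Prop :=
  fderiv ℝ H w = 0 ∧ ∀ v : ℂ, v ≠ 0 → hessQ H w v < 0

/-- `w` is a nondegenerate local minimum of `H` (critical with positive
definite Hessian). -/
def IsNondegMin (H : ℂ → ℝ) (w : ℂ) : Prop :=
  fderiv ℝ H w = 0 ∧ ∀ v : ℂ, v ≠ 0 → hessQ H w v > 0

/-- `w` is a nondegenerate saddle point of `H`: critical, the Hessian takes
both signs (signature `(1,1)` on `ℝ² ≅ ℂ`), and the Hessian bilinear form is
nondegenerate. -/
def IsNondegSaddle (H : ℂ → ℝ) (w : ℂ) : Prop :=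
  fderiv ℝ H w = 0 ∧
  (∃ v : ℂ, hessQ H w v > 0) ∧
  (∃ v : ℂ, hessQ H w v < 0) ∧
  (∀ v : ℂ, (∀ u : ℂ, fderiv ℝ (fderiv ℝ H) w v u = 0) → v = 0)


open Filter Topology

lemma glue_hasDerivAt {x : ℝ} (hx : 0 < x) :
    HasDerivAt expNegInvGlue (Real.exp (-x⁻¹) * (x⁻¹)^2) x := by
  have h : HasDerivAt (fun y : ℝ => Real.exp (-y⁻¹)) (Real.exp (-x⁻¹) * (x⁻¹)^2) x := by
    have h0 : HasDerivAt (fun y : ℝ => -y⁻¹) (-(-(x^2)⁻¹)) x := (hasDerivAt_inv hx.ne').neg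
    have := h0.exp
    refine this.congr_deriv ?_
    rw [neg_neg, inv_pow]
  refine h.congr_of_eventuallyEq ?_
  filter_upwards [lt_mem_nhds hx] with y hy
  simp [expNegInvGlue, not_le.mpr hy]

lemma oneplus_anti : StrictAntiOn (fun t : ℝ => (1 + t) * Real.exp (-t)) (Set.Ici 0) := by
  apply strictAntiOn_of_deriv_neg (convex_Ici 0) (by fun_prop)
  intro t ht
  rw [interior_Ici] at ht
  have : HasDerivAt (fun t : ℝ => (1 + t) * Real.exp (-t)) (1 * Real.exp (-t) + (1 + t) * (Real.exp (-t) * (-1))) t :=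
    ((hasDerivAt_id t).const_add 1).mul ((hasDerivAt_id t).neg.exp)
  rw [this.deriv]
  have h1 := Real.exp_pos (-t)
  have ht' : 0 < t := ht
  nlinarith [mul_pos ht' h1]

noncomputable def uu1 (x : ℝ) : ℝ := Real.exp 1 / 2 * (x * expNegInvGlue x)

lemma uu1_contDiff : ContDiff ℝ (⊤ : ℕ∞) uu1 := by
  unfold uu1
  exact contDiff_const.mul (contDiff_id.mul expNegInvGlue.contDiff)

lemma uu1_hasDerivAt {x : ℝ} (hx : 0 < x) :
    HasDerivAt uu1 (Real.exp 1 / 2 * ((1 + x⁻¹) * Real.exp (-x⁻¹))) x := by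
  have := ((hasDerivAt_id x).mul (glue_hasDerivAt hx)).const_mul (Real.exp 1 / 2)
  refine HasDerivAt.congr_deriv (f := uu1) this ?_
  simp only [expNegInvGlue, not_le.mpr hx, if_false, id]
  field_simp

lemma uu1_deriv_one : Real.exp 1 / 2 * ((1 + (1:ℝ)⁻¹) * Real.exp (-(1:ℝ)⁻¹)) = 1 := by
  have : Real.exp 1 * Real.exp (-1) = 1 := by rw [← Real.exp_add]; simp
  norm_num
  linarith

lemma uu1_deriv_gt {x : ℝ} (hx : 1 < x) :
    1 < Real.exp 1 / 2 * ((1 + x⁻¹) * Real.exp (-x⁻¹)) := by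
  have h := oneplus_anti (a := x⁻¹) (b := (1:ℝ)⁻¹) (by simp; linarith) (by simp) (by gcongr)
  refine lt_of_eq_of_lt uu1_deriv_one.symm ?_
  have := Real.exp_pos 1
  simp only at h
  gcongr

lemma uu1_deriv_lt {x : ℝ} (h0 : 0 < x) (hx : x < 1) :
    Real.exp 1 / 2 * ((1 + x⁻¹) * Real.exp (-x⁻¹)) < 1 := by
  have h := oneplus_anti (a := (1:ℝ)⁻¹) (b := x⁻¹) (by simp) (by simp; linarith) (by gcongr)
  conv_rhs => rw [← uu1_deriv_one]
  have := Real.exp_pos 1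
  simp only at h
  gcongr

lemma uu1_deriv2 : 0 < deriv (deriv uu1) 1 := by
  have e : deriv uu1 =ᶠ[𝓝 1] fun x => Real.exp 1 / 2 * ((1 + x⁻¹) * Real.exp (-x⁻¹)) := by
    filter_upwards [lt_mem_nhds (zero_lt_one (α := ℝ))] with y hy
    exact (uu1_hasDerivAt hy).deriv
  rw [e.deriv_eq]
  have hi := hasDerivAt_inv (one_ne_zero (α := ℝ))
  have := ((hi.const_add 1).mul (hi.neg.exp)).const_mul (Real.exp 1 / 2)
  have h2 := this.deriv
  simp only [Pi.mul_def, Pi.neg_def] at h2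
  erw [h2]
  have := Real.exp_pos 1
  have h3 := Real.exp_pos (-1)
  norm_num
  have := mul_pos this h3
  linarith

lemma uu1_zero {x : ℝ} (hx : x ≤ 0) : uu1 x = 0 := by
  simp [uu1, expNegInvGlue.zero_of_nonpos hx]

lemma uu1_pos {x : ℝ} (hx : 0 < x) : 0 < uu1 x := by
  have := expNegInvGlue.pos_of_pos hx
  have := Real.exp_pos 1
  unfold uu1; positivity

lemma uu1_lt {x : ℝ} (hx : 0 < x) : uu1 x < 2 * x := by
  have h1 : expNegInvGlue x ≤ 1 := by
    simp [expNegInvGlue, not_le.mpr hx]; positivity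
  have h0 := expNegInvGlue.pos_of_pos hx
  have h2 := Real.exp_one_lt_d9
  unfold uu1
  have h3 : x * expNegInvGlue x ≤ x := by nlinarith
  have h4 : 0 < x * expNegInvGlue x := by positivity
  nlinarith

lemma st_deriv_nonneg (x : ℝ) : 0 ≤ deriv Real.smoothTransition x :=
  Real.smoothTransition.monotone.deriv_nonneg

lemma st_deriv_bdd : ∃ M : ℝ, 0 ≤ M ∧ ∀ x, deriv Real.smoothTransition x ≤ M := by
  have hc : Continuous (deriv Real.smoothTransition) :=
    (Real.smoothTransition.contDiff (n := 1)).continuous_deriv le_rfl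
  obtain ⟨M, hM⟩ := (isCompact_Icc (a := (0:ℝ)) (b := 1)).bddAbove_image hc.continuousOn
  refine ⟨max M 0, le_max_right _ _, fun x => ?_⟩
  by_cases hx : x ∈ Set.Icc (0:ℝ) 1
  · exact le_max_of_le_left (hM ⟨x, hx, rfl⟩)
  · refine le_max_of_le_right (le_of_eq ?_)
    rw [Set.mem_Icc, not_and_or, not_le, not_le] at hx
    rcases hx with hx | hx
    · have : Real.smoothTransition =ᶠ[𝓝 x] fun _ => (0:ℝ) := by
        filter_upwards [gt_mem_nhds hx] with y hy
        exact Real.smoothTransition.zero_of_nonpos hy.le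
      rw [this.deriv_eq]; simp
    · have : Real.smoothTransition =ᶠ[𝓝 x] fun _ => (1:ℝ) := by
        filter_upwards [lt_mem_nhds hx] with y hy
        exact Real.smoothTransition.one_of_one_le hy.le
      rw [this.deriv_eq]; simp

lemma sqrt_hasDerivAt {t : ℝ} (ht : 1 < t) :
    HasDerivAt (fun t : ℝ => √(t^2-1)) (t / √(t^2-1)) t := by
  have : HasDerivAt (fun t : ℝ => t^2-1) (2*t) t := by
    simpa using (hasDerivAt_pow 2 t).sub_const 1
  have h := this.sqrt (by nlinarith)
  convert h using 1
  have : 0 < √(t^2-1) := Real.sqrt_pos.mpr (by nlinarith)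
  field_simp

lemma sqrt_contDiffAt {t : ℝ} (ht : 1 < t) : ContDiffAt ℝ (⊤ : ℕ∞) (fun t : ℝ => √(t^2-1)) t :=
  ContDiffAt.sqrt (by fun_prop) (by nlinarith)

lemma st_contDiff : ContDiff ℝ (⊤ : ℕ∞) Real.smoothTransition := Real.smoothTransition.contDiff

lemma one_dim (T : ℝ) (hT : 1 < T) : ∃ (T₂ T₀ : ℝ) (u v : ℝ → ℝ), T < T₀ ∧ T₀ < T₂ ∧
    (∀ t, 1 < t → ContDiffAt ℝ (⊤ : ℕ∞) u t) ∧ (∀ t, 1 < t → ContDiffAt ℝ (⊤ : ℕ∞) v t) ∧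
    (∀ t, t ≤ T → u t = 0) ∧ (∀ t, t ≤ T → v t = 0) ∧
    (∀ t, T₂ ≤ t → u t = t + √(t^2-1)) ∧ (∀ t, T₂ ≤ t → v t = t - √(t^2-1)) ∧
    (∀ t, 1 < t → 0 ≤ v t) ∧ (∀ t, T < t → v t < u t) ∧
    (∀ t, T < t → t ≠ T₀ → deriv u t ≠ 1) ∧ deriv u T₀ = 1 ∧ 0 < deriv (deriv u) T₀ ∧
    (∀ t, T < t → deriv v t < 1) := by
  obtain ⟨M, hM0, hM⟩ := st_deriv_bdd
  set L := M + 1 with hL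
  have hLpos : 0 < L := by linarith
  have hs : ∀ t : ℝ, 1 < t → 0 < √(t^2-1) := fun t ht => Real.sqrt_pos.mpr (by nlinarith)
  have hs1 : ∀ t : ℝ, 1 < t → t - 1 ≤ √(t^2-1) := fun t ht =>
    Real.le_sqrt_of_sq_le (by nlinarith)
  have hs2 : ∀ t : ℝ, 1 < t → √(t^2-1) < t := fun t ht => by
    rw [Real.sqrt_lt' (by linarith)]; linarith
  set u : ℝ → ℝ := fun t => (1 - Real.smoothTransition (t - T - 2)) * uu1 (t - T) +
    Real.smoothTransition (t - T - 2) * (t + √(t^2-1)) with hu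
  set v : ℝ → ℝ := fun t => Real.smoothTransition ((t - T - 3) / L) * (t - √(t^2-1)) with hv
  have hloc : ∀ t, t < T + 2 → u =ᶠ[𝓝 t] fun t => uu1 (t - T) := by
    intro t ht
    filter_upwards [gt_mem_nhds ht] with y hy
    simp [hu, Real.smoothTransition.zero_of_nonpos (show y - T - 2 ≤ 0 by linarith)]
  have hd1 : ∀ t, T < t → HasDerivAt (fun t => uu1 (t - T))
      (Real.exp 1 / 2 * ((1 + (t-T)⁻¹) * Real.exp (-(t-T)⁻¹))) t := fun t ht =>
    (uu1_hasDerivAt (sub_pos.mpr ht)).comp_sub_const t T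
  have hstd : ∀ x, HasDerivAt Real.smoothTransition (deriv Real.smoothTransition x) x := fun x =>
    (st_contDiff.differentiable (by simp) x).hasDerivAt
  refine ⟨T + 3 + L, T + 1, u, v, by linarith, by linarith, ?_, ?_, ?_, ?_, ?_, ?_, ?_, ?_, ?_, ?_, ?_, ?_⟩
  · intro t ht
    have h1 : ContDiff ℝ (⊤ : ℕ∞) fun t => Real.smoothTransition (t - T - 2) :=
      st_contDiff.comp (by fun_prop)
    have h2 : ContDiff ℝ (⊤ : ℕ∞) fun t => uu1 (t - T) := uu1_contDiff.comp (by fun_prop)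
    exact ((contDiff_const.sub h1).mul h2).contDiffAt.add
      (h1.contDiffAt.mul (contDiffAt_id.add (sqrt_contDiffAt ht)))
  · intro t ht
    have h1 : ContDiff ℝ (⊤ : ℕ∞) fun t => Real.smoothTransition ((t - T - 3) / L) :=
      st_contDiff.comp (by fun_prop)
    exact (h1.contDiffAt.mul (contDiffAt_id.sub (sqrt_contDiffAt ht)))
  · intro t ht
    simp [hu, Real.smoothTransition.zero_of_nonpos (show t - T - 2 ≤ 0 by linarith),
      uu1_zero (show t - T ≤ 0 by linarith)]
  · intro t ht
    simp [hv, Real.smoothTransition.zero_of_nonpos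
      (show (t - T - 3) / L ≤ 0 from div_nonpos_of_nonpos_of_nonneg (by linarith) hLpos.le)]
  · intro t ht
    simp [hu, Real.smoothTransition.one_of_one_le (show 1 ≤ t - T - 2 by linarith)]
  · intro t ht
    simp [hv, Real.smoothTransition.one_of_one_le
      (show 1 ≤ (t - T - 3) / L by rw [le_div_iff₀ hLpos]; linarith)]
  · intro t ht
    exact mul_nonneg (Real.smoothTransition.nonneg _) (by linarith [hs2 t ht])
  · intro t ht
    have h1 := Real.smoothTransition.nonneg (t - T - 2)
    have h2 := Real.smoothTransition.le_one (t - T - 2)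
    have h1' := Real.smoothTransition.nonneg ((t - T - 3) / L)
    have h2' := Real.smoothTransition.le_one ((t - T - 3) / L)
    have hst := hs t (by linarith)
    have hst2 := hs2 t (by linarith)
    rcases lt_or_ge t (T + 3) with h | h
    · have hv0 : v t = 0 := by
        simp [hv, Real.smoothTransition.zero_of_nonpos
          (show (t - T - 3) / L ≤ 0 from div_nonpos_of_nonpos_of_nonneg (by linarith) hLpos.le)]
      rw [hv0]
      have h3 := uu1_pos (sub_pos.mpr ht)
      have : 0 < t + √(t^2-1) := by linarith
      simp only [hu]
      rcases h1.eq_or_lt with h0 | h0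
      · rw [← h0]; simpa using h3
      · have := mul_pos h0 this
        have := mul_nonneg (sub_nonneg.mpr h2) h3.le
        linarith
    · have hu0 : u t = t + √(t^2-1) := by
        simp [hu, Real.smoothTransition.one_of_one_le (show 1 ≤ t - T - 2 by linarith)]
      rw [hu0]
      simp only [hv]
      nlinarith
  · intro t ht hne
    rcases lt_or_gt_of_ne hne with h | h
    · rw [(hloc t (by linarith)).deriv_eq, (hd1 t ht).deriv]
      exact (uu1_deriv_lt (by linarith) (by linarith)).ne
    · have ht1 : 1 < t := by linarith
      have hχ : HasDerivAt (fun t => Real.smoothTransition (t - T - 2))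
          (deriv Real.smoothTransition (t - T - 2)) t := by
        have : HasDerivAt (fun t : ℝ => t - T - 2) 1 t :=
          ((hasDerivAt_id t).sub_const T).sub_const 2
        exact ((hstd (t - T - 2)).comp t this).congr_deriv (mul_one _)
      have hdu := ((hχ.const_sub 1).mul (hd1 t ht)).add
        (hχ.mul ((hasDerivAt_id t).add (sqrt_hasDerivAt ht1)))
      have e : deriv u t = _ := hdu.deriv
      rw [e]
      have h1 := Real.smoothTransition.nonneg (t - T - 2)
      have h2 := Real.smoothTransition.le_one (t - T - 2)
      have h3 := st_deriv_nonneg (t - T - 2)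
      have h4 := uu1_deriv_gt (x := t - T) (by linarith)
      have h5 := uu1_lt (x := t - T) (by linarith)
      have h6 := hs1 t ht1
      have h7 : 0 < t / √(t^2-1) := div_pos (by linarith) (hs t ht1)
      have h7' : 1 < t / √(t^2-1) := (one_lt_div (hs t ht1)).mpr (hs2 t ht1)
      simp only [Pi.add_apply, id]
      generalize Real.exp 1 / 2 * ((1 + (t-T)⁻¹) * Real.exp (-(t-T)⁻¹)) = d at *
      generalize Real.smoothTransition (t - T - 2) = χ at *
      generalize deriv Real.smoothTransition (t - T - 2) = χ' at *
      generalize t / √(t^2-1) = e at *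
      have : 0 ≤ χ' * (t + √(t^2-1) - uu1 (t-T)) := mul_nonneg h3 (by linarith)
      have h8 := mul_nonneg (sub_nonneg.mpr h2) (sub_pos.mpr h4).le
      rcases h1.eq_or_lt with h0 | h0
      · subst h0
        nlinarith
      · have := mul_pos h0 h7
        nlinarith
  · rw [(hloc (T+1) (by linarith)).deriv_eq, (hd1 (T+1) (by linarith)).deriv]
    simpa using uu1_deriv_one
  · have e : deriv u =ᶠ[𝓝 (T+1)] fun t => deriv uu1 (t - T) := by
      refine (hloc (T+1) (by linarith)).deriv.trans (Eventually.of_forall fun t => ?_)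
      exact deriv_comp_sub_const uu1 T t
    rw [e.deriv_eq, deriv_comp_sub_const (deriv uu1) T]
    simpa using uu1_deriv2
  · intro t ht
    have ht1 : 1 < t := by linarith
    have hχ : HasDerivAt (fun t => Real.smoothTransition ((t - T - 3) / L))
        (deriv Real.smoothTransition ((t - T - 3) / L) * (1 / L)) t := by
      have : HasDerivAt (fun t : ℝ => (t - T - 3) / L) (1 / L) t :=
        (((hasDerivAt_id t).sub_const T).sub_const 3).div_const L
      exact (hstd ((t - T - 3) / L)).comp t this
    have hdv := hχ.mul ((hasDerivAt_id t).sub (sqrt_hasDerivAt ht1))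
    have e : deriv v t = _ := hdv.deriv
    rw [e]
    have h1 := Real.smoothTransition.nonneg ((t - T - 3) / L)
    have h3 := st_deriv_nonneg ((t - T - 3) / L)
    have h4 := hM ((t - T - 3) / L)
    have h6 := hs1 t ht1
    have h7' : 1 < t / √(t^2-1) := (one_lt_div (hs t ht1)).mpr (hs2 t ht1)
    have h8 := hs2 t ht1
    simp only [Pi.sub_apply, id]
    have h5 : deriv Real.smoothTransition ((t - T - 3) / L) * (1 / L) < 1 := by
      rw [mul_one_div, div_lt_one hLpos]; linarith
    have h5' : 0 ≤ deriv Real.smoothTransition ((t - T - 3) / L) * (1 / L) := by positivity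
    generalize deriv Real.smoothTransition ((t - T - 3) / L) * (1 / L) = d at *
    generalize Real.smoothTransition ((t - T - 3) / L) = χ at *
    generalize t / √(t^2-1) = e at *
    nlinarith


/-- radial-type function -/
noncomputable def HAB (A B : ℝ → ℝ) (w : ℂ) : ℝ := A (Complex.normSq w) + B (Complex.normSq w) * w.re

noncomputable def nsL (w : ℂ) : ℂ →L[ℝ] ℝ := (2 * w.re) • Complex.reCLM + (2 * w.im) • Complex.imCLM

lemma ns_hasFDerivAt (w : ℂ) : HasFDerivAt (fun z : ℂ => Complex.normSq z) (nsL w) w := by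
  have h1 : HasFDerivAt (fun z : ℂ => z.re) Complex.reCLM w := Complex.reCLM.hasFDerivAt
  have h2 : HasFDerivAt (fun z : ℂ => z.im) Complex.imCLM w := Complex.imCLM.hasFDerivAt
  have := (h1.mul h1).add (h2.mul h2)
  have e : (fun z : ℂ => Complex.normSq z) = (fun z : ℂ => z.re * z.re + z.im * z.im) := by
    ext z; exact Complex.normSq_apply z
  rw [e]
  refine this.congr_fderiv ?_
  ext <;> simp [nsL] <;> ring

lemma ns_contDiff : ContDiff ℝ (⊤ : ℕ∞) (fun z : ℂ => Complex.normSq z) := by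
  have e : (fun z : ℂ => Complex.normSq z) = (fun z : ℂ => Complex.reCLM z * Complex.reCLM z + Complex.imCLM z * Complex.imCLM z) := by
    ext z; exact Complex.normSq_apply z
  rw [e]
  fun_prop

lemma HAB_hasFDerivAt {A B : ℝ → ℝ} {w : ℂ} {a b : ℝ}
    (hA : HasDerivAt A a (Complex.normSq w)) (hB : HasDerivAt B b (Complex.normSq w)) :
    HasFDerivAt (HAB A B) ((a + b * w.re) • nsL w + (B (Complex.normSq w)) • Complex.reCLM) w := by
  have h1 : HasFDerivAt (fun z : ℂ => z.re) Complex.reCLM w := Complex.reCLM.hasFDerivAt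
  have h3 := hA.comp_hasFDerivAt w (ns_hasFDerivAt w)
  have h4 := hB.comp_hasFDerivAt w (ns_hasFDerivAt w)
  have := h3.add (h4.mul h1)
  refine HasFDerivAt.congr_fderiv (f := HAB A B) this ?_
  ext <;> simp <;> ring

lemma HAB_contDiffAt {A B : ℝ → ℝ} {w : ℂ}
    (hA : ContDiffAt ℝ (⊤ : ℕ∞) A (Complex.normSq w))
    (hB : ContDiffAt ℝ (⊤ : ℕ∞) B (Complex.normSq w)) :
    ContDiffAt ℝ (⊤ : ℕ∞) (HAB A B) w := by
  have h1 : ContDiffAt ℝ (⊤ : ℕ∞) (fun z : ℂ => z.re) w := Complex.reCLM.contDiff.contDiffAt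
  exact (hA.comp w ns_contDiff.contDiffAt).add ((hB.comp w ns_contDiff.contDiffAt).mul h1)

lemma contDiffAt_deriv1 {A : ℝ → ℝ} {s : ℝ} (hA : ContDiffAt ℝ (⊤ : ℕ∞) A s) :
    ContDiffAt ℝ 1 (deriv A) s := by
  have h := (hA.fderiv_right (m := 1) (by norm_cast)).clm_apply
    (contDiffAt_const (c := (1:ℝ)))
  exact h

lemma HAB_hess {A B : ℝ → ℝ} {w : ℂ} (him : w.im = 0)
    (hA : ContDiffAt ℝ (⊤ : ℕ∞) A (Complex.normSq w))
    (hB : ContDiffAt ℝ (⊤ : ℕ∞) B (Complex.normSq w)) (v u : ℂ) :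
    fderiv ℝ (fderiv ℝ (HAB A B)) w v u =
      (2 * (deriv A (Complex.normSq w) + deriv B (Complex.normSq w) * w.re)
       + 4 * w.re ^ 2 * (deriv (deriv A) (Complex.normSq w) + deriv (deriv B) (Complex.normSq w) * w.re)
       + 4 * w.re * deriv B (Complex.normSq w)) * (v.re * u.re)
      + 2 * (deriv A (Complex.normSq w) + deriv B (Complex.normSq w) * w.re) * (v.im * u.im) := by
  have hd : DifferentiableAt ℝ (fderiv ℝ (HAB A B)) w := by
    have := (HAB_contDiffAt hA hB).fderiv_right (m := 1) (by norm_cast)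
    exact this.differentiableAt (by simp)
  have e1 : fderiv ℝ (fderiv ℝ (HAB A B)) w v u = fderiv ℝ (fun z => fderiv ℝ (HAB A B) z u) w v := by
    rw [fderiv_clm_apply hd (by fun_prop)]
    simp
  have hA1 : ∀ᶠ s in 𝓝 (Complex.normSq w), HasDerivAt A (deriv A s) s := by
    filter_upwards [(hA.of_le (m := 1) (by exact_mod_cast le_top)).eventually (by simp)] with s hs
    exact (hs.differentiableAt (by simp)).hasDerivAt
  have hB1 : ∀ᶠ s in 𝓝 (Complex.normSq w), HasDerivAt B (deriv B s) s := by
    filter_upwards [(hB.of_le (m := 1) (by exact_mod_cast le_top)).eventually (by simp)] with s hs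
    exact (hs.differentiableAt (by simp)).hasDerivAt
  have hA2 : HasDerivAt (deriv A) (deriv (deriv A) (Complex.normSq w)) (Complex.normSq w) := by
    have : ContDiffAt ℝ 1 (deriv A) (Complex.normSq w) := contDiffAt_deriv1 hA
    exact (this.differentiableAt (by simp)).hasDerivAt
  have hB2 : HasDerivAt (deriv B) (deriv (deriv B) (Complex.normSq w)) (Complex.normSq w) := by
    have : ContDiffAt ℝ 1 (deriv B) (Complex.normSq w) := contDiffAt_deriv1 hB
    exact (this.differentiableAt (by simp)).hasDerivAt
  have hc : Tendsto (fun z : ℂ => Complex.normSq z) (𝓝 w) (𝓝 (Complex.normSq w)) :=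
    ns_contDiff.continuous.continuousAt
  have e2 : (fun z => fderiv ℝ (HAB A B) z u) =ᶠ[𝓝 w] fun z =>
      (deriv A (Complex.normSq z) + deriv B (Complex.normSq z) * z.re) *
        (2 * z.re * u.re + 2 * z.im * u.im) + B (Complex.normSq z) * u.re := by
    filter_upwards [hc.eventually hA1, hc.eventually hB1] with z h1 h2
    rw [(HAB_hasFDerivAt h1 h2).fderiv]
    simp [nsL]
    ring
  rw [e1, e2.fderiv_eq]
  have h1 : HasFDerivAt (fun z : ℂ => z.re) Complex.reCLM w := Complex.reCLM.hasFDerivAt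
  have h2 : HasFDerivAt (fun z : ℂ => z.im) Complex.imCLM w := Complex.imCLM.hasFDerivAt
  have hn := ns_hasFDerivAt w
  have k1 := hA2.comp_hasFDerivAt w hn
  have k2 := hB2.comp_hasFDerivAt w hn
  have k3 := hB1.self_of_nhds.comp_hasFDerivAt w hn
  have k := ((k1.add (k2.mul h1)).mul (((h1.const_mul 2).mul_const u.re).add
    ((h2.const_mul 2).mul_const u.im))).add (k3.mul_const u.re)
  have k' := k.fderiv
  simp only [Pi.add_def, Pi.mul_def, Function.comp_def] at k'
  rw [k']
  simp [nsL, him]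
  ring

noncomputable def tau (s : ℝ) : ℝ := (1 + s) / (1 - s)

noncomputable def sig (t : ℝ) : ℝ := (t - 1) / (t + 1)

lemma tau_hasDerivAt {s : ℝ} (hs : s < 1) : HasDerivAt tau (2 / (1 - s)^2) s := by
  have h1 : HasDerivAt (fun s : ℝ => 1 + s) 1 s := (hasDerivAt_id s).const_add 1
  have h2 : HasDerivAt (fun s : ℝ => 1 - s) (-1) s := (hasDerivAt_id s).const_sub 1
  refine HasDerivAt.congr_deriv (f := tau) (h1.div h2 (by linarith)) ?_
  have : 1 - s ≠ 0 := by linarith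
  field_simp
  ring

lemma tau_contDiffAt {s : ℝ} (hs : s < 1) : ContDiffAt ℝ (⊤ : ℕ∞) tau s := by
  unfold tau
  exact ContDiffAt.div (by fun_prop) (by fun_prop) (by linarith)

lemma tau_lt {a b : ℝ} (hab : a < b) (hb : b < 1) : tau a < tau b := by
  unfold tau
  rw [div_lt_div_iff₀ (by linarith) (by linarith)]
  nlinarith

lemma tau_lt_iff {a b : ℝ} (ha : a < 1) (hb : b < 1) : tau a < tau b ↔ a < b := by
  refine ⟨fun h => ?_, fun h => tau_lt h hb⟩
  by_contra h'
  rcases (not_lt.mp h').eq_or_lt with e | e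
  · rw [e] at h; exact lt_irrefl _ h
  · exact lt_asymm h (tau_lt e ha)

lemma tau_le_iff {a b : ℝ} (ha : a < 1) (hb : b < 1) : tau a ≤ tau b ↔ a ≤ b := by
  rw [← not_lt, ← not_lt, tau_lt_iff hb ha]

lemma tau_inj {a b : ℝ} (ha : a < 1) (hb : b < 1) (h : tau a = tau b) : a = b :=
  le_antisymm ((tau_le_iff ha hb).1 h.le) ((tau_le_iff hb ha).1 h.ge)

lemma sig_lt_one {t : ℝ} (ht : 1 < t) : sig t < 1 := by
  unfold sig; rw [div_lt_one (by linarith)]; linarith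

lemma sig_pos {t : ℝ} (ht : 1 < t) : 0 < sig t := by
  unfold sig; exact div_pos (by linarith) (by linarith)

lemma tau_sig {t : ℝ} (ht : 1 < t) : tau (sig t) = t := by
  unfold tau sig
  have : t + 1 ≠ 0 := by linarith
  field_simp
  ring

lemma one_lt_tau {s : ℝ} (h0 : 0 < s) (h1 : s < 1) : 1 < tau s := by
  unfold tau; rw [one_lt_div (by linarith)]; linarith

lemma tau_pos_of {s : ℝ} (h1 : s < 1) (h : 1 < tau s) : 0 < s := by
  unfold tau at h; rw [one_lt_div (by linarith)] at h; linarith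

noncomputable def AA (u v : ℝ → ℝ) (s : ℝ) : ℝ :=
  Real.pi / 2 * (-tau s + (u (tau s) + v (tau s)) / 2)

noncomputable def BB (u v : ℝ → ℝ) (s : ℝ) : ℝ :=
  Real.pi / 2 * ((u (tau s) - v (tau s)) / (2 * √s))

section
variable {T : ℝ} {u v : ℝ → ℝ}

lemma AA_contDiffAt (hT : 1 < T) (hu : ∀ t, 1 < t → ContDiffAt ℝ (⊤ : ℕ∞) u t)
    (hv : ∀ t, 1 < t → ContDiffAt ℝ (⊤ : ℕ∞) v t)
    (hu0 : ∀ t, t ≤ T → u t = 0) (hv0 : ∀ t, t ≤ T → v t = 0) {s : ℝ} (hs : s < 1) :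
    ContDiffAt ℝ (⊤ : ℕ∞) (AA u v) s := by
  have ht := tau_contDiffAt hs
  rcases lt_or_ge (tau s) T with h | h
  · have : AA u v =ᶠ[𝓝 s] fun s => Real.pi / 2 * (-tau s) := by
      filter_upwards [ht.continuousAt.eventually (gt_mem_nhds h)] with y hy
      simp [AA, hu0 _ (le_of_lt hy), hv0 _ (le_of_lt hy)]
    exact (contDiffAt_const.mul ht.neg).congr_of_eventuallyEq this
  · have h1 : 1 < tau s := by linarith
    exact contDiffAt_const.mul (ht.neg.add
      ((((hu _ h1).comp s ht).add ((hv _ h1).comp s ht)).div_const 2))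

lemma BB_contDiffAt (hT : 1 < T) (hu : ∀ t, 1 < t → ContDiffAt ℝ (⊤ : ℕ∞) u t)
    (hv : ∀ t, 1 < t → ContDiffAt ℝ (⊤ : ℕ∞) v t)
    (hu0 : ∀ t, t ≤ T → u t = 0) (hv0 : ∀ t, t ≤ T → v t = 0) {s : ℝ} (hs : s < 1) :
    ContDiffAt ℝ (⊤ : ℕ∞) (BB u v) s := by
  have ht := tau_contDiffAt hs
  rcases lt_or_ge (tau s) T with h | h
  · have : BB u v =ᶠ[𝓝 s] fun s => 0 := by
      filter_upwards [ht.continuousAt.eventually (gt_mem_nhds h)] with y hy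
      simp [BB, hu0 _ (le_of_lt hy), hv0 _ (le_of_lt hy)]
    exact contDiffAt_const.congr_of_eventuallyEq this
  · have h1 : 1 < tau s := by linarith
    have hs0 := tau_pos_of hs h1
    have hsq : ContDiffAt ℝ (⊤ : ℕ∞) (fun s : ℝ => √s) s := ContDiffAt.sqrt contDiffAt_id hs0.ne'
    exact contDiffAt_const.mul ((((hu _ h1).comp s ht).sub ((hv _ h1).comp s ht)).div
      (contDiffAt_const.mul hsq) (by positivity))

lemma deriv_eq_left {f g : ℝ → ℝ} {s a b : ℝ} (hf : HasDerivAt f a s) (hg : HasDerivAt g b s)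
    (h : ∀ y ≤ s, f y = g y) : a = b := by
  have h1 := hf.hasDerivWithinAt (s := Set.Iic s)
  have h2 : HasDerivWithinAt f b (Set.Iic s) s :=
    hg.hasDerivWithinAt.congr (fun y hy => h y hy) (h s le_rfl)
  exact (uniqueDiffOn_Iic s s (by simp)).eq_deriv _ h1 h2

lemma AA_deriv_left (hA : ∀ s < 1, ContDiffAt ℝ (⊤ : ℕ∞) (AA u v) s)
    (hu0 : ∀ t, t ≤ T → u t = 0) (hv0 : ∀ t, t ≤ T → v t = 0) {s : ℝ} (hs : s < 1)
    (hsT : tau s ≤ T) : deriv (AA u v) s < 0 := by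
  have h1 := ((hA s hs).differentiableAt (by simp)).hasDerivAt
  have h2 : HasDerivAt (fun s => Real.pi / 2 * (-tau s)) _ s :=
    ((tau_hasDerivAt hs).neg).const_mul (Real.pi / 2)
  rw [deriv_eq_left h1 h2 ?_]
  · have := Real.pi_pos
    have : 0 < 1 - s := by linarith
    have : 0 < Real.pi / 2 * (2 / (1-s)^2) := by positivity
    linarith
  · intro y hy
    have : tau y ≤ T := ((tau_le_iff (by linarith) hs).2 hy).trans hsT
    simp [AA, hu0 _ this, hv0 _ this]

lemma BB_deriv_left (hB : ∀ s < 1, ContDiffAt ℝ (⊤ : ℕ∞) (BB u v) s)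
    (hu0 : ∀ t, t ≤ T → u t = 0) (hv0 : ∀ t, t ≤ T → v t = 0) {s : ℝ} (hs : s < 1)
    (hsT : tau s ≤ T) : deriv (BB u v) s = 0 := by
  have h1 := ((hB s hs).differentiableAt (by simp)).hasDerivAt
  refine deriv_eq_left h1 (hasDerivAt_const s (0:ℝ)) ?_
  intro y hy
  have : tau y ≤ T := ((tau_le_iff (by linarith) hs).2 hy).trans hsT
  simp [BB, hu0 _ this, hv0 _ this]

lemma comp_sq0 {f : ℝ → ℝ} {a x : ℝ} (hf : HasDerivAt f a (x^2)) :
    HasDerivAt (fun x => f (x^2)) (a * (2 * x)) x := by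
  have hp : HasDerivAt (fun x : ℝ => x^2) (2 * x) x := by simpa using hasDerivAt_pow 2 x
  exact HasDerivAt.comp (h := fun x : ℝ => x^2) (h₂ := f) x hf hp

/-- Derivative of the restriction to the real axis. -/
noncomputable def DD (A B : ℝ → ℝ) (x : ℝ) : ℝ :=
  2 * x * (deriv A (x^2) + deriv B (x^2) * x) + B (x^2)

lemma DD_axis {A B : ℝ → ℝ} {x : ℝ} (hA : ContDiffAt ℝ (⊤ : ℕ∞) A (x^2))
    (hB : ContDiffAt ℝ (⊤ : ℕ∞) B (x^2)) :
    HasDerivAt (fun x => A (x^2) + B (x^2) * x) (DD A B x) x := by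
  have h1 : HasDerivAt (fun x => A (x^2)) _ x :=
    comp_sq0 (hA.differentiableAt (by simp)).hasDerivAt
  have h2 : HasDerivAt (fun x => B (x^2)) _ x :=
    comp_sq0 (hB.differentiableAt (by simp)).hasDerivAt
  refine (h1.add (h2.mul (hasDerivAt_id x))).congr_deriv ?_
  simp only [DD, id]; ring

lemma DD_hasDerivAt {A B : ℝ → ℝ} {x : ℝ} (hA : ContDiffAt ℝ (⊤ : ℕ∞) A (x^2))
    (hB : ContDiffAt ℝ (⊤ : ℕ∞) B (x^2)) :
    HasDerivAt (DD A B) (2 * (deriv A (x^2) + deriv B (x^2) * x)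
       + 4 * x ^ 2 * (deriv (deriv A) (x^2) + deriv (deriv B) (x^2) * x)
       + 4 * x * deriv B (x^2)) x := by
  have h0 : HasDerivAt (fun x => B (x^2)) _ x :=
    comp_sq0 (hB.differentiableAt (by simp)).hasDerivAt
  have h1 : HasDerivAt (fun x => deriv A (x^2)) _ x :=
    comp_sq0 ((contDiffAt_deriv1 hA).differentiableAt (by simp)).hasDerivAt
  have h2 : HasDerivAt (fun x => deriv B (x^2)) _ x :=
    comp_sq0 ((contDiffAt_deriv1 hB).differentiableAt (by simp)).hasDerivAt
  have h3 : HasDerivAt (fun x : ℝ => 2 * x) (2 * 1) x := (hasDerivAt_id x).const_mul 2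
  refine HasDerivAt.congr_deriv (f := DD A B)
    ((h3.mul (h1.add (h2.mul (hasDerivAt_id x)))).add h0) ?_
  simp only [Pi.add_apply, Pi.mul_apply, id]; ring

lemma axis_chain {f : ℝ → ℝ} {x : ℝ} (hx : x^2 < 1) (hf : DifferentiableAt ℝ f (tau (x^2))) :
    HasDerivAt (fun x => Real.pi / 2 * (-tau (x^2) + f (tau (x^2))))
      (Real.pi / 2 * ((deriv f (tau (x^2)) - 1) * (2 / (1 - x^2)^2 * (2 * x)))) x := by
  have h1 : HasDerivAt (fun x => tau (x^2)) _ x := comp_sq0 (tau_hasDerivAt hx)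
  have h2 : HasDerivAt (fun x => f (tau (x^2))) _ x := HasDerivAt.comp x hf.hasDerivAt h1
  refine ((h1.neg.add h2).const_mul (Real.pi / 2)).congr_deriv ?_
  ring

lemma axis_pos {x : ℝ} (hx : 0 < x) :
    AA u v (x^2) + BB u v (x^2) * x = Real.pi / 2 * (-tau (x^2) + u (tau (x^2))) := by
  unfold AA BB
  rw [Real.sqrt_sq hx.le]
  field_simp
  ring

lemma axis_neg {x : ℝ} (hx : x < 0) :
    AA u v (x^2) + BB u v (x^2) * x = Real.pi / 2 * (-tau (x^2) + v (tau (x^2))) := by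
  unfold AA BB
  rw [← neg_sq x, Real.sqrt_sq (by linarith : 0 ≤ -x)]
  have hx' : x ≠ 0 := hx.ne
  simp only [neg_sq]
  field_simp
  ring

lemma DD_pos (hu : ∀ t, 1 < t → ContDiffAt ℝ (⊤ : ℕ∞) u t)
    (hA : ∀ s < 1, ContDiffAt ℝ (⊤ : ℕ∞) (AA u v) s)
    (hB : ∀ s < 1, ContDiffAt ℝ (⊤ : ℕ∞) (BB u v) s) {x : ℝ} (hx : 0 < x) (hx1 : x^2 < 1) :
    DD (AA u v) (BB u v) x =
      Real.pi / 2 * ((deriv u (tau (x^2)) - 1) * (2 / (1 - x^2)^2 * (2 * x))) := by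
  have h1 := DD_axis (hA _ hx1) (hB _ hx1)
  have h2 := axis_chain hx1 ((hu _ (one_lt_tau (by positivity) hx1)).differentiableAt (by simp))
  refine h1.unique (h2.congr_of_eventuallyEq ?_)
  filter_upwards [lt_mem_nhds hx] with y hy using axis_pos hy

lemma DD_neg (hv : ∀ t, 1 < t → ContDiffAt ℝ (⊤ : ℕ∞) v t)
    (hA : ∀ s < 1, ContDiffAt ℝ (⊤ : ℕ∞) (AA u v) s)
    (hB : ∀ s < 1, ContDiffAt ℝ (⊤ : ℕ∞) (BB u v) s) {x : ℝ} (hx : x < 0) (hx1 : x^2 < 1) :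
    DD (AA u v) (BB u v) x =
      Real.pi / 2 * ((deriv v (tau (x^2)) - 1) * (2 / (1 - x^2)^2 * (2 * x))) := by
  have h1 := DD_axis (hA _ hx1) (hB _ hx1)
  have h2 := axis_chain hx1 ((hv _ (one_lt_tau (by nlinarith) hx1)).differentiableAt (by simp))
  refine h1.unique (h2.congr_of_eventuallyEq ?_)
  filter_upwards [gt_mem_nhds hx] with y hy using axis_neg hy

lemma DD_deriv_pos (hu : ∀ t, 1 < t → ContDiffAt ℝ (⊤ : ℕ∞) u t)
    (hA : ∀ s < 1, ContDiffAt ℝ (⊤ : ℕ∞) (AA u v) s)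
    (hB : ∀ s < 1, ContDiffAt ℝ (⊤ : ℕ∞) (BB u v) s) {x : ℝ} (hx : 0 < x) (hx1 : x^2 < 1)
    (h1 : deriv u (tau (x^2)) = 1) (h2 : 0 < deriv (deriv u) (tau (x^2))) :
    0 < deriv (DD (AA u v) (BB u v)) x := by
  have e : DD (AA u v) (BB u v) =ᶠ[𝓝 x] fun x =>
      Real.pi / 2 * ((deriv u (tau (x^2)) - 1) * (2 / (1 - x^2)^2 * (2 * x))) := by
    have hc : ContinuousAt (fun x : ℝ => x^2) x := by fun_prop
    filter_upwards [lt_mem_nhds hx, hc.eventually (gt_mem_nhds hx1)] with y hy hy1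
    exact DD_pos hu hA hB hy hy1
  rw [e.deriv_eq]
  have k1 : HasDerivAt (fun x => tau (x^2)) _ x := comp_sq0 (tau_hasDerivAt hx1)
  have k2 : HasDerivAt (fun x => deriv u (tau (x^2))) _ x := HasDerivAt.comp (h := fun x => tau (x^2)) (h₂ := deriv u) x
    ((contDiffAt_deriv1 (hu _ (one_lt_tau (by positivity) hx1))).differentiableAt
      (by simp)).hasDerivAt k1
  have hne : 1 - x^2 ≠ 0 := by linarith
  have k3 : DifferentiableAt ℝ (fun x : ℝ => 2 / (1 - x^2)^2 * (2 * x)) x := by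
    have : (1 - x^2)^2 ≠ 0 := pow_ne_zero 2 hne
    fun_prop (disch := assumption)
  have k := ((k2.sub_const 1).mul k3.hasDerivAt).const_mul (Real.pi / 2)
  have k' : deriv (fun x =>
      Real.pi / 2 * ((deriv u (tau (x^2)) - 1) * (2 / (1 - x^2)^2 * (2 * x)))) x = _ := k.deriv
  rw [k', h1]
  have := Real.pi_pos
  have : 0 < 1 - x^2 := by linarith
  simp only [sub_self, zero_mul, add_zero]
  positivity

end

lemma HAB_apply {A B : ℝ → ℝ} {w : ℂ} (hA : ContDiffAt ℝ (⊤ : ℕ∞) A (Complex.normSq w))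
    (hB : ContDiffAt ℝ (⊤ : ℕ∞) B (Complex.normSq w)) (z : ℂ) :
    fderiv ℝ (HAB A B) w z = (deriv A (Complex.normSq w) + deriv B (Complex.normSq w) * w.re) *
      (2 * w.re * z.re + 2 * w.im * z.im) + B (Complex.normSq w) * z.re := by
  rw [(HAB_hasFDerivAt (hA.differentiableAt (by simp)).hasDerivAt
    (hB.differentiableAt (by simp)).hasDerivAt).fderiv]
  simp [nsL]
  ring

/-- For every `ρ₁ ∈ (0,1)` there are `ρ₂ ∈ (ρ₁,1)` and a smooth `H₂ : W → ℝ`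
with `H₂ ≥ −H^rot` on `W`, equality on `{|w| ≤ ρ₁}`, `H₂ = H^hyp` on
`{ρ₂ ≤ |w| < 1}`, and exactly two critical points: a nondegenerate local
maximum at `0` and a nondegenerate saddle `w₂` with `ρ₁ < |w₂| < ρ₂`. -/
theorem interpolating_morse_function_exists (ρ₁ : ℝ) (hρ₁ : ρ₁ ∈ Set.Ioo (0 : ℝ) 1) :
    ∃ ρ₂ ∈ Set.Ioo ρ₁ (1 : ℝ), ∃ H₂ : ℂ → ℝ, ∃ w₂ : ℂ,
      ContDiffOn ℝ (⊤ : ℕ∞) H₂ Wdisc ∧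
      (∀ w ∈ Wdisc, -Hrot w ≤ H₂ w) ∧
      (∀ w : ℂ, ‖w‖ ≤ ρ₁ → H₂ w = -Hrot w) ∧
      (∀ w : ℂ, ρ₂ ≤ ‖w‖ → ‖w‖ < 1 → H₂ w = Hhyp w) ∧
      ρ₁ < ‖w₂‖ ∧ ‖w₂‖ < ρ₂ ∧
      {w ∈ Wdisc | fderiv ℝ H₂ w = 0} = {0, w₂} ∧
      IsNondegMax H₂ 0 ∧
      IsNondegSaddle H₂ w₂ := by
  obtain ⟨h0, h1⟩ := hρ₁
  have hr1 : ρ₁ ^ 2 < 1 := by nlinarith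
  have hr0 : 0 < ρ₁ ^ 2 := by positivity
  obtain ⟨T, hTdef⟩ : ∃ T, T = tau (ρ₁^2) := ⟨_, rfl⟩
  have hT : 1 < T := hTdef ▸ one_lt_tau hr0 hr1
  obtain ⟨T₂, T₀, u, v, hT0, hT02, hu, hv, hu0, hv0, hu2, hv2, hvnn, hvu, hune, hu1, hu11, hv1⟩ :=
    one_dim T hT
  have hA : ∀ s < 1, ContDiffAt ℝ (⊤ : ℕ∞) (AA u v) s := fun s hs =>
    AA_contDiffAt hT hu hv hu0 hv0 hs
  have hB : ∀ s < 1, ContDiffAt ℝ (⊤ : ℕ∞) (BB u v) s := fun s hs =>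
    BB_contDiffAt hT hu hv hu0 hv0 hs
  have hpi := Real.pi_pos
  have hT0' : 1 < T₀ := by linarith
  have hT2' : 1 < T₂ := by linarith
  have hns : ∀ w ∈ Wdisc, Complex.normSq w < 1 := by
    intro w hw
    have : ‖w‖ < 1 := by simpa [Wdisc] using hw
    rw [Complex.normSq_eq_norm_sq]
    nlinarith [norm_nonneg w]
  have hBpos : ∀ s < 1, T < tau s → 0 < BB u v s := by
    intro s hs hts
    have := tau_pos_of hs (by linarith)
    have := sub_pos.mpr (hvu _ hts)
    unfold BB
    positivity
  have hBzero : ∀ s, tau s ≤ T → BB u v s = 0 := by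
    intro s hs
    simp [BB, hu0 _ hs, hv0 _ hs]
  have hrot : ∀ w : ℂ, Hrot w = Real.pi / 2 * tau (Complex.normSq w) := by
    intro w
    rw [Complex.normSq_eq_norm_sq]; unfold Hrot tau; ring
  have hrot_eq : ∀ w : ℂ, tau (Complex.normSq w) ≤ T → HAB (AA u v) (BB u v) w = -Hrot w := by
    intro w hw
    rw [hrot]
    simp [HAB, AA, BB, hu0 _ hw, hv0 _ hw]
  have hsig0 := sig_pos hT0'
  have hsig1 := sig_lt_one hT0'
  obtain ⟨x₀, hx₀⟩ : ∃ x, x = √(sig T₀) := ⟨_, rfl⟩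
  have hxpos : 0 < x₀ := hx₀ ▸ Real.sqrt_pos.mpr hsig0
  have hxsq : x₀^2 = sig T₀ := by rw [hx₀, Real.sq_sqrt hsig0.le]
  have hx1 : x₀^2 < 1 := by rw [hxsq]; exact hsig1
  have htx : tau (x₀^2) = T₀ := by rw [hxsq, tau_sig hT0']
  have hns0 : Complex.normSq (x₀ : ℂ) = x₀^2 := by rw [Complex.normSq_ofReal]; ring
  have hw0 : Complex.normSq 0 < 1 := by simp
  have htau0 : tau (Complex.normSq 0) ≤ T := by simp [tau]; linarith
  have hDD0 : DD (AA u v) (BB u v) x₀ = 0 := by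
    rw [DD_pos hu hA hB hxpos hx1, htx, hu1]; simp
  have hDD1 : 0 < deriv (DD (AA u v) (BB u v)) x₀ :=
    DD_deriv_pos hu hA hB hxpos hx1 (by rw [htx, hu1]) (by rw [htx]; exact hu11)
  rw [(DD_hasDerivAt (hA _ hx1) (hB _ hx1)).deriv] at hDD1
  have hBx : 0 < BB u v (x₀^2) := hBpos _ hx1 (by rw [htx]; exact hT0)
  have hC : deriv (AA u v) (x₀^2) + deriv (BB u v) (x₀^2) * x₀ < 0 := by
    unfold DD at hDD0
    by_contra hcon
    have := mul_nonneg hxpos.le (not_lt.mp hcon)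
    nlinarith
  have crit0 : fderiv ℝ (HAB (AA u v) (BB u v)) 0 = 0 := by
    ext z <;> rw [HAB_apply (hA _ hw0) (hB _ hw0), hBzero _ htau0] <;> simp
  have critx : fderiv ℝ (HAB (AA u v) (BB u v)) (x₀ : ℂ) = 0 := by
    have hw : Complex.normSq (x₀ : ℂ) < 1 := by rw [hns0]; exact hx1
    unfold DD at hDD0
    apply ContinuousLinearMap.ext
    intro z
    rw [HAB_apply (hA _ hw) (hB _ hw), hns0]
    simp only [Complex.ofReal_re, Complex.ofReal_im, ContinuousLinearMap.zero_apply]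
    linear_combination z.re * hDD0
  refine ⟨√(sig T₂), ⟨?_, ?_⟩, HAB (AA u v) (BB u v), (x₀ : ℂ), ?_, ?_, ?_, ?_, ?_, ?_, ?_, ?_, ?_⟩
  · apply Real.lt_sqrt_of_sq_lt
    rw [← tau_lt_iff hr1 (sig_lt_one hT2'), tau_sig hT2', ← hTdef]
    linarith
  · rw [Real.sqrt_lt' one_pos]
    simpa using sig_lt_one hT2'
  · intro w hw
    exact (HAB_contDiffAt (hA _ (hns w hw)) (hB _ (hns w hw))).contDiffWithinAt
  · intro w hw
    rcases le_or_gt (tau (Complex.normSq w)) T with h | h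
    · exact (hrot_eq w h).ge
    · have hs := hns w hw
      have hs0 := tau_pos_of hs (by linarith)
      rw [hrot]
      have hb := hBpos _ hs h
      have hre : -√(Complex.normSq w) ≤ w.re := by
        have := Complex.abs_re_le_norm w
        rw [Complex.normSq_eq_norm_sq, Real.sqrt_sq (norm_nonneg w)]
        exact (abs_le.mp this).1
      have hb2 : BB u v (Complex.normSq w) * √(Complex.normSq w) =
          Real.pi / 2 * ((u (tau (Complex.normSq w)) - v (tau (Complex.normSq w))) / 2) := by
        have := Real.sqrt_pos.mpr hs0
        unfold BB
        field_simp
      have hb3 := mul_le_mul_of_nonneg_left hre hb.le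
      have hv3 := mul_nonneg hpi.le (hvnn (tau (Complex.normSq w)) (by linarith))
      unfold HAB AA
      nlinarith
  · intro w hw
    apply hrot_eq
    have : Complex.normSq w ≤ ρ₁^2 := by
      rw [Complex.normSq_eq_norm_sq]; gcongr
    rw [hTdef]
    exact (tau_le_iff (by linarith) hr1).2 this
  · intro w hw hw1
    have hs : Complex.normSq w < 1 := hns w (by simpa [Wdisc] using hw1)
    have hle : sig T₂ ≤ Complex.normSq w := by
      rw [Complex.normSq_eq_norm_sq]
      exact (Real.sqrt_le_left (norm_nonneg w)).mp hw
    have ht2 : T₂ ≤ tau (Complex.normSq w) := by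
      rw [← tau_sig hT2']
      exact (tau_le_iff (sig_lt_one hT2') hs).2 hle
    have hwpos : 0 < ‖w‖ := lt_of_lt_of_le (Real.sqrt_pos.mpr (sig_pos hT2')) hw
    have hn : 0 < 1 - ‖w‖^2 := by nlinarith
    unfold HAB AA BB Hhyp
    rw [hu2 _ ht2, hv2 _ ht2]
    have e : √(tau (Complex.normSq w) ^ 2 - 1) = 2 * ‖w‖ / (1 - ‖w‖^2) := by
      rw [Complex.normSq_eq_norm_sq, Real.sqrt_eq_iff_mul_self_eq_of_pos (by positivity)]
      unfold tau
      field_simp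
      ring
    rw [e, Complex.normSq_eq_norm_sq, Real.sqrt_sq hwpos.le]
    field_simp
    ring
  · rw [Complex.norm_real, Real.norm_of_nonneg hxpos.le, hx₀]
    apply Real.lt_sqrt_of_sq_lt
    rw [← tau_lt_iff hr1 hsig1, tau_sig hT0', ← hTdef]
    linarith
  · rw [Complex.norm_real, Real.norm_of_nonneg hxpos.le, hx₀]
    apply Real.sqrt_lt_sqrt hsig0.le
    rw [← tau_lt_iff hsig1 (sig_lt_one hT2'), tau_sig hT0', tau_sig hT2']
    exact hT02
  · ext w
    simp only [Set.mem_setOf_eq, Set.mem_insert_iff, Set.mem_singleton_iff]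
    constructor
    · rintro ⟨hw, hcrit⟩
      have hs := hns w hw
      have e1 := HAB_apply (hA _ hs) (hB _ hs) 1
      have e2 := HAB_apply (hA _ hs) (hB _ hs) Complex.I
      rw [hcrit] at e1 e2
      simp only [ContinuousLinearMap.zero_apply, Complex.one_re, Complex.one_im, Complex.I_re,
        Complex.I_im, mul_one, mul_zero, add_zero, zero_add] at e1 e2
      rcases le_or_gt (tau (Complex.normSq w)) T with h | h
      · left
        rw [hBzero _ h, BB_deriv_left hB hu0 hv0 hs h] at e1
        rw [BB_deriv_left hB hu0 hv0 hs h] at e2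
        have hd := (AA_deriv_left hA hu0 hv0 hs h).ne
        simp [hd] at e1 e2
        exact Complex.ext e1 e2
      · right
        have hb := hBpos _ hs h
        have him : w.im = 0 := by
          rcases mul_eq_zero.mp e2.symm with h' | h'
          · rw [h'] at e1; linarith
          · linarith
        have hn : Complex.normSq w = w.re^2 := by
          rw [Complex.normSq_apply, him]; ring
        have hD : DD (AA u v) (BB u v) w.re = 0 := by
          unfold DD; rw [← hn]; linear_combination -e1
        rw [hn] at hs h
        have hpos : 0 < w.re^2 := tau_pos_of hs (by linarith)
        have hnz : w.re ≠ 0 := fun hz => by rw [hz] at hpos; norm_num at hpos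
        have hq : (2 / (1 - w.re^2)^2 * (2 * w.re)) ≠ 0 := by
          have : 1 - w.re^2 ≠ 0 := by linarith
          positivity
        rcases lt_or_gt_of_ne hnz with hlt | hgt
        · rw [DD_neg hv hA hB hlt hs] at hD
          have hd := hv1 _ h
          have : deriv v (tau (w.re^2)) - 1 ≠ 0 := by linarith
          exact absurd hD (mul_ne_zero (by positivity) (mul_ne_zero this hq))
        · rw [DD_pos hu hA hB hgt hs] at hD
          have ht : tau (w.re^2) = T₀ := by
            by_contra hne
            have : deriv u (tau (w.re^2)) - 1 ≠ 0 := sub_ne_zero.mpr (hune _ h hne)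
            exact absurd hD (mul_ne_zero (by positivity) (mul_ne_zero this hq))
          have hsq : w.re^2 = x₀^2 := tau_inj hs hx1 (by rw [ht, htx])
          have hre : w.re = x₀ := by
            rwa [sq_eq_sq₀ hgt.le hxpos.le] at hsq
          exact Complex.ext (by simpa using hre) (by simpa using him)
    · rintro (rfl | rfl)
      · exact ⟨by simp [Wdisc], crit0⟩
      · refine ⟨?_, critx⟩
        have : x₀ < 1 := by nlinarith
        simpa [Wdisc, abs_of_pos hxpos] using this
  · refine ⟨crit0, fun z hz => ?_⟩
    unfold hessQ
    rw [HAB_hess (by simp) (hA _ hw0) (hB _ hw0), BB_deriv_left hB hu0 hv0 hw0 htau0]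
    have hd := AA_deriv_left hA hu0 hv0 hw0 htau0
    have hz' := Complex.normSq_pos.mpr hz
    rw [Complex.normSq_apply] at hz'
    simp only [Complex.zero_re]
    nlinarith [mul_neg_of_neg_of_pos hd hz']
  · have hw : Complex.normSq (x₀ : ℂ) < 1 := by rw [hns0]; exact hx1
    have hh := HAB_hess (w := (x₀ : ℂ)) (by simp) (hA _ hw) (hB _ hw)
    rw [hns0] at hh
    simp only [Complex.ofReal_re] at hh
    generalize 2 * (deriv (AA u v) (x₀^2) + deriv (BB u v) (x₀^2) * x₀)
       + 4 * x₀ ^ 2 * (deriv (deriv (AA u v)) (x₀^2) + deriv (deriv (BB u v)) (x₀^2) * x₀)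
       + 4 * x₀ * deriv (BB u v) (x₀^2) = P at *
    generalize deriv (AA u v) (x₀^2) + deriv (BB u v) (x₀^2) * x₀ = Q at *
    refine ⟨critx, ⟨1, ?_⟩, ⟨Complex.I, ?_⟩, fun z hz => ?_⟩
    · unfold hessQ; rw [hh]; simpa using hDD1
    · unfold hessQ; rw [hh]; simp; linarith
    · have z1 := hz 1
      have z2 := hz Complex.I
      rw [hh] at z1 z2
      simp [hDD1.ne', hC.ne] at z1 z2
      exact Complex.ext z1 z2
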